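/- Let c ∈ (3/2, 5/2], f_0 > 0, and let a(t) be a solution of the inviscid dyadic model (ν = 0) on [0, ∞) with a(0) ∈ l²(ℕ) and a_j(0) ≥ 0 for all j. Then the time-averaged anomalous energy dissipation rate converges to a positive constant: lim_{T→∞} (1/T) [ (|a(0)|² − |a(T)|²)/2 + ∫_0^T f_0 a_0(t) dt ] = ε_d, where ε_d = 2^{c/6} f_0^{3/2} > 0. -/

import Mathlib

open Filter MeasureTheory intervalIntegral

/-- Right-hand side of the dyadic model ODE for the `j`-th component:
`d/dt a_j = f_j - ν 2^{2j} a_j + 2^{c(j-1)} a_{j-1}² - 2^{cj} a_j a_{j+1}`,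
with the conventions `a_{-1} = 0`, `f_0 = f₀`, `f_j = 0` for `j ≥ 1`. -/
noncomputable def dyadicRHS (ν c f₀ : ℝ) (a : ℕ → ℝ) (j : ℕ) : ℝ :=
  (if j = 0 then f₀ else 0) - ν * (2 : ℝ) ^ (2 * j) * a j
    + (if j = 0 then 0 else (2 : ℝ) ^ (c * ((j : ℝ) - 1)) * a (j - 1) ^ 2)
    - (2 : ℝ) ^ (c * (j : ℝ)) * a j * a (j + 1)

/-- A solution of the dyadic model on `[0, ∞)`: an `l²`-valued function whose
components are differentiable on `[0, ∞)` and satisfy the dyadic system. -/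
def IsSolution (ν c f₀ : ℝ) (a : ℝ → ℕ → ℝ) : Prop :=
  (∀ t : ℝ, 0 ≤ t → Summable (fun j : ℕ => a t j ^ 2)) ∧
  ∀ j : ℕ, ∀ t : ℝ, 0 ≤ t →
    HasDerivWithinAt (fun s : ℝ => a s j) (dyadicRHS ν c f₀ (a t) j) (Set.Ici 0) t

/-- A fixed point of the dyadic model: an `l²` sequence `α` with
`ν 2^{2j} α_j - 2^{c(j-1)} α_{j-1}² + 2^{cj} α_j α_{j+1} = f_j` for all `j ≥ 0`. -/
def IsFixedPoint (ν c f₀ : ℝ) (α : ℕ → ℝ) : Prop :=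
  (Summable fun j : ℕ => α j ^ 2) ∧
  ∀ j : ℕ, dyadicRHS ν c f₀ α j = 0

lemma dy_bound {F F' G : ℝ → ℝ} (hF : ∀ t, 0 ≤ t → HasDerivWithinAt F (F' t) (Set.Ici 0) t)
    (hG : ContinuousOn G (Set.Ici 0)) {s t : ℝ} (hs : 0 ≤ s) (hst : s ≤ t)
    (hle : ∀ x, s ≤ x → x ≤ t → F' x ≤ G x) :
    F t - F s ≤ ∫ x in s..t, G x := by
  have hsub : Set.Icc s t ⊆ Set.Ici 0 := fun x hx => hs.trans hx.1
  apply intervalIntegral.sub_le_integral_of_hasDeriv_right_of_le hst (g' := F')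
  · intro x hx
    exact ((hF x (hsub hx)).continuousWithinAt).mono hsub
  · intro x hx
    exact (hF x (hs.trans hx.1.le)).mono (fun y hy => (hs.trans hx.1.le).trans (le_of_lt hy))
  · exact (hG.mono hsub).integrableOn_Icc
  · intro x hx
    exact hle x hx.1.le hx.2.le

lemma dy_nonneg {y g h : ℝ → ℝ}
    (hy : ∀ t, 0 ≤ t → HasDerivWithinAt y (g t - h t * y t) (Set.Ici 0) t)
    (hg : ∀ t, 0 ≤ t → 0 ≤ g t) (hh : ContinuousOn h (Set.Ici 0)) (h0 : 0 ≤ y 0) :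
    ∀ t, 0 ≤ t → 0 ≤ y t := by
  have hc : Continuous (fun s : ℝ => h (max s 0)) := by
    apply hh.comp_continuous (continuous_id.max continuous_const)
    intro x; exact le_max_right x (0:ℝ)
  set H : ℝ → ℝ := fun t => ∫ s in (0:ℝ)..t, h (max s 0) with hH
  have hHd : ∀ t, HasDerivAt H (h (max t 0)) t := fun t =>
    intervalIntegral.integral_hasDerivAt_right (hc.intervalIntegrable _ _)
      (hc.stronglyMeasurableAtFilter _ _) hc.continuousAt
  have hz : ∀ t, 0 ≤ t → HasDerivWithinAt (fun t => Real.exp (H t) * y t)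
      (Real.exp (H t) * g t) (Set.Ici 0) t := by
    intro t ht
    have h1 := ((hHd t).exp.hasDerivWithinAt (s := Set.Ici 0)).mul (hy t ht)
    refine HasDerivWithinAt.congr_deriv h1 ?_
    rw [max_eq_left ht]; ring
  intro t ht
  have h2 := dy_bound (F := fun t => -(Real.exp (H t) * y t)) (G := fun _ => 0)
    (fun t ht => (hz t ht).neg) continuousOn_const le_rfl ht (by
      intro x hx _
      have := mul_nonneg (Real.exp_pos (H x)).le (hg x hx)
      linarith)
  simp only [intervalIntegral.integral_zero] at h2
  have h3 : 0 ≤ Real.exp (H 0) * y 0 := mul_nonneg (Real.exp_pos _).le h0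
  have h4 : 0 ≤ Real.exp (H t) * y t := by linarith
  exact nonneg_of_mul_nonneg_right h4 (Real.exp_pos _)

set_option maxHeartbeats 1000000 in
/-- the core estimate in terms of `q = 2^c`, `r = 2^(-c/3)` and the fixed point `K r^j`. -/
lemma dy_core {q r K f : ℝ} (hr : 0 < r) (hr1 : r < 1) (hq : 0 < q) (hK : 0 < K)
    (hqr : q * r ^ 3 = 1) (hKf : K ^ 2 * r = f) (h1 : 1 ≤ q / 2 * r) (h2 : q / 2 * r ^ 2 < 1)
    (a : ℝ → ℕ → ℝ)
    (hS : ∀ t : ℝ, 0 ≤ t → Summable (fun j : ℕ => a t j ^ 2))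
    (hd0 : ∀ t, 0 ≤ t → HasDerivWithinAt (fun s => a s 0) (f - a t 0 * a t 1) (Set.Ici 0) t)
    (hd : ∀ j t, 0 ≤ t → HasDerivWithinAt (fun s => a s (j+1))
      (q ^ j * a t j ^ 2 - q ^ (j+1) * a t (j+1) * a t (j+2)) (Set.Ici 0) t)
    (hpos : ∀ j, 0 ≤ a 0 j) :
    ∃ G : ℝ, 0 ≤ G ∧ ∀ T, 1 ≤ T → (∑' j, a T j ^ 2) ≤ G ∧
      ∫ t in (0:ℝ)..T, (a t 0 - K) ^ 2 ≤ G := by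
  have hf : 0 < f := by rw [← hKf]; positivity
  have hcont : ∀ j, ContinuousOn (fun s => a s j) (Set.Ici 0) := by
    intro j t ht
    cases j with
    | zero => exact (hd0 t ht).continuousWithinAt
    | succ j => exact (hd j t ht).continuousWithinAt
  have hnn : ∀ j t, 0 ≤ t → 0 ≤ a t j := by
    intro j
    cases j with
    | zero =>
      apply dy_nonneg (g := fun _ => f) (h := fun t => a t 1) _ (fun _ _ => hf.le) (hcont 1) (hpos 0)
      intro t ht
      convert hd0 t ht using 1
      ring
    | succ j =>
      apply dy_nonneg (g := fun t => q ^ j * a t j ^ 2) (h := fun t => q ^ (j+1) * a t (j+2)) _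
        (fun _ _ => by positivity) (continuousOn_const.mul (hcont _)) (hpos _)
      intro t ht
      convert hd j t ht using 1
      ring
  -- energy
  have hE : ∀ N t, 0 ≤ t → HasDerivWithinAt (fun s => ∑ j ∈ Finset.range (N+1), a s j ^ 2)
      (2 * f * a t 0 - 2 * q ^ N * a t N ^ 2 * a t (N+1)) (Set.Ici 0) t := by
    intro N t ht
    induction N with
    | zero =>
      simp only [zero_add, Finset.sum_range_one]
      refine HasDerivWithinAt.congr_deriv ((hd0 t ht).pow 2) ?_
      simp; ring
    | succ N ih =>
      simp only [Finset.sum_range_succ _ (N+1)]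
      refine HasDerivWithinAt.congr_deriv (ih.add ((hd N t ht).pow 2)) ?_
      simp; ring
  have hEle : ∀ N s t, 0 ≤ s → s ≤ t → (∑ j ∈ Finset.range (N+1), a t j ^ 2)
      - (∑ j ∈ Finset.range (N+1), a s j ^ 2) ≤ ∫ x in s..t, 2 * f * a x 0 := by
    intro N s t hs hst
    apply dy_bound (G := fun x => 2 * f * a x 0) (hE N) (continuousOn_const.mul (hcont 0)) hs hst
    intro x hx _
    have := hnn (N+1) x (hs.trans hx)
    have : 0 ≤ 2 * q ^ N * a x N ^ 2 * a x (N+1) := by positivity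
    linarith
  -- local bound
  have hloc : ∀ T, 0 ≤ T → ∃ C, 0 ≤ C ∧ ∀ j t, 0 ≤ t → t ≤ T → a t j ≤ C := by
    intro T hT
    obtain ⟨A, hA⟩ := (isCompact_Icc (a := (0:ℝ)) (b := T)).exists_bound_of_continuousOn
      ((hcont 0).mono (fun x hx => hx.1))
    have hA0 : 0 ≤ A := (norm_nonneg _).trans (hA 0 ⟨le_rfl, hT⟩)
    have hX : 0 ≤ (∑' j, a 0 j ^ 2) := tsum_nonneg (fun j => sq_nonneg _)
    refine ⟨(∑' j, a 0 j ^ 2) + 2 * f * A * T + 1, by positivity, ?_⟩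
    intro j t ht htT
    have e1 := hEle j 0 t le_rfl ht
    have e2 : ∫ x in (0:ℝ)..t, 2 * f * a x 0 ≤ ∫ x in (0:ℝ)..t, 2 * f * A := by
      apply intervalIntegral.integral_mono_on ht
      · apply ContinuousOn.intervalIntegrable
        rw [Set.uIcc_of_le ht]
        exact (continuousOn_const.mul (hcont 0)).mono (fun x hx => hx.1)
      · simp
      · intro x hx
        have := hA x ⟨hx.1, hx.2.trans htT⟩
        have := (le_abs_self _).trans this
        gcongr
    rw [intervalIntegral.integral_const, smul_eq_mul, sub_zero] at e2
    have e3 : t * (2 * f * A) ≤ 2 * f * A * T := by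
      rw [mul_comm]; gcongr
    have e4 := (hS 0 le_rfl).sum_le_tsum (Finset.range (j+1)) (fun i _ => sq_nonneg _)
    have e5 : a t j ^ 2 ≤ ∑ i ∈ Finset.range (j+1), a t i ^ 2 :=
      Finset.single_le_sum (f := fun i => a t i ^ 2) (fun i _ => sq_nonneg _) (by simp)
    nlinarith [sq_nonneg (a t j - 1)]
  -- Lyapunov functional
  set b : ℝ → ℕ → ℝ := fun t j => a t j - K * r ^ j with hb
  have hbc : ∀ j, ContinuousOn (fun s => b s j) (Set.Ici 0) := fun j =>
    (hcont j).sub continuousOn_const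
  have hW : ∀ N t, 0 ≤ t → HasDerivWithinAt
      (fun s => ∑ j ∈ Finset.range (N+1), (1/2:ℝ) ^ j * b s j ^ 2)
      (-(∑ j ∈ Finset.range N, (q/2) ^ j * b t j ^ 2 * (a t (j+1) + K * r ^ (j+1)))
        - 2 * (q/2) ^ N * b t N * (a t N * a t (N+1) - K * r ^ N * (K * r ^ (N+1))))
      (Set.Ici 0) t := by
    intro N t ht
    induction N with
    | zero =>
      simp only [zero_add, Finset.sum_range_one]
      refine HasDerivWithinAt.congr_deriv
        ((((hd0 t ht).sub_const (K * r ^ 0)).pow 2).const_mul ((1/2:ℝ)^0)) ?_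
      simp [hb, ← hKf]; ring
    | succ N ih =>
      simp only [Finset.sum_range_succ _ (N+1)]
      refine HasDerivWithinAt.congr_deriv (ih.add
        ((((hd N t ht).sub_const (K * r ^ (N+1))).pow 2).const_mul ((1/2:ℝ)^(N+1)))) ?_
      rw [Finset.sum_range_succ]
      have k1 : q ^ N * (K * r ^ N) ^ 2 = q ^ (N+1) * (K * r ^ (N+1)) * (K * r ^ (N+2)) := by
        calc q ^ N * (K * r ^ N) ^ 2 = q ^ N * (K * r ^ N) ^ 2 * 1 := by ring
          _ = q ^ N * (K * r ^ N) ^ 2 * (q * r ^ 3) := by rw [hqr]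
          _ = _ := by ring
      have k2 : (q/2) ^ N = q ^ N * (1/2) ^ N := by rw [← mul_pow]; ring_nf
      have k3 : (q/2) ^ (N+1) = q ^ N * q * ((1/2) ^ N * (1/2)) := by rw [pow_succ, k2]; ring
      have k4 : (1/2:ℝ) ^ (N+1) = (1/2) ^ N * (1/2) := pow_succ _ _
      have k5 : q ^ (N+1) = q ^ N * q := pow_succ _ _
      simp only [hb, Nat.add_sub_cancel, Nat.cast_ofNat, pow_one, k3, k2, k4, k5] at k1 ⊢
      simp only [show (2 - 1 : ℕ) = 1 from rfl, pow_one, show N + 1 + 1 = N + 2 from rfl]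
      generalize K * r ^ N = x at *
      generalize K * r ^ (N+1) = y at *
      generalize K * r ^ (N+2) = z at *
      generalize (1/2:ℝ) ^ N = h at *
      linear_combination h * (a t (N+1) - y) * k1
  set κ := K * r with hκ
  have hκ0 : 0 < κ := by positivity
  set θ := q / 2 * r ^ 2 with hθ
  have hθ0 : 0 ≤ θ := by positivity
  have hWle : ∀ T, 0 ≤ T → ∃ D, ∀ N t, 0 ≤ t → t ≤ T →
      (-(∑ j ∈ Finset.range N, (q/2) ^ j * b t j ^ 2 * (a t (j+1) + K * r ^ (j+1)))
        - 2 * (q/2) ^ N * b t N * (a t N * a t (N+1) - K * r ^ N * (K * r ^ (N+1))))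
      ≤ D * θ ^ N - κ * ∑ j ∈ Finset.range N, b t j ^ 2 := by
    intro T hT
    obtain ⟨C, hC0, hC⟩ := hloc T hT
    refine ⟨2 * (K ^ 2 * C + K ^ 2 * r * C), ?_⟩
    intro N t ht htT
    have s1 : κ * ∑ j ∈ Finset.range N, b t j ^ 2 ≤
        ∑ j ∈ Finset.range N, (q/2) ^ j * b t j ^ 2 * (a t (j+1) + K * r ^ (j+1)) := by
      rw [Finset.mul_sum]
      apply Finset.sum_le_sum
      intro j _
      have p1 : 1 ≤ (q/2 * r) ^ j := one_le_pow₀ h1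
      have p2 : 0 ≤ (q/2) ^ j * b t j ^ 2 * a t (j+1) :=
        mul_nonneg (by positivity) (hnn _ _ ht)
      have p3 : (q/2) ^ j * b t j ^ 2 * (K * r ^ (j+1)) = κ * b t j ^ 2 * (q/2*r)^j := by
        rw [mul_pow, hκ]; ring
      have p4 : κ * b t j ^ 2 * 1 ≤ κ * b t j ^ 2 * (q/2*r)^j := by gcongr
      linarith
    have s2 : - (b t N * (a t N * a t (N+1) - K * r ^ N * (K * r ^ (N+1)))) ≤
        (r ^ 2) ^ N * (K ^ 2 * C + K ^ 2 * r * C) := by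
      have e1 := hC N t ht htT
      have e2 := hC (N+1) t ht htT
      have e3 := hnn N t ht
      have e4 := hnn (N+1) t ht
      have e5 : (r ^ 2) ^ N * (K ^ 2 * C + K ^ 2 * r * C) =
        (K * r ^ N) ^ 2 * C + (K * r ^ N) * (K * r ^ (N+1)) * C := by ring
      rw [e5]
      simp only [hb]
      have x0 : 0 < K * r ^ N := by positivity
      have y0 : 0 < K * r ^ (N+1) := by positivity
      generalize K * r ^ N = x at *
      generalize K * r ^ (N+1) = y at *
      generalize a t N = u at *
      generalize a t (N+1) = v at *
      have i1 : x * u - u ^ 2 ≤ x ^ 2 := by nlinarith [sq_nonneg (x - u)]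
      have i2 : (x * u - u ^ 2) * v ≤ x ^ 2 * v := by gcongr
      have i3 : x ^ 2 * v ≤ x ^ 2 * C := by gcongr
      have i4 : x * y * u ≤ x * y * C := by gcongr
      have i5 : 0 ≤ x ^ 2 * y := by positivity
      nlinarith
    have s3 : 2 * (q/2) ^ N * (- (b t N * (a t N * a t (N+1) - K * r ^ N * (K * r ^ (N+1))))) ≤
        2 * (q/2) ^ N * ((r ^ 2) ^ N * (K ^ 2 * C + K ^ 2 * r * C)) := by gcongr
    have s4 : 2 * (q/2) ^ N * ((r ^ 2) ^ N * (K ^ 2 * C + K ^ 2 * r * C)) =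
       2 * (K ^ 2 * C + K ^ 2 * r * C) * θ ^ N := by rw [hθ, mul_pow]; ring
    linarith
  have hαS : Summable (fun j : ℕ => (K * r ^ j) ^ 2) := by
    have : Summable (fun j : ℕ => K ^ 2 * (r ^ 2) ^ j) :=
      (summable_geometric_of_lt_one (by positivity) (by nlinarith)).mul_left _
    refine this.congr (fun j => by ring)
  have hbS : Summable (fun j : ℕ => b 0 j ^ 2) := by
    apply Summable.of_nonneg_of_le (fun j => sq_nonneg _) _
      (((hS 0 le_rfl).add hαS).mul_left 2)
    intro j
    simp only [hb]
    nlinarith [sq_nonneg (a 0 j + K * r ^ j)]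
  set B := ∑' j, b 0 j ^ 2 with hB
  have hB0 : 0 ≤ B := tsum_nonneg (fun j => sq_nonneg _)
  have hsumc : ∀ M, ContinuousOn (fun s => ∑ j ∈ Finset.range M, b s j ^ 2) (Set.Ici 0) := by
    intro M
    exact continuousOn_finsetSum _ (fun j _ => (hbc j).pow 2)
  have hint : ∀ (g : ℝ → ℝ), ContinuousOn g (Set.Ici 0) → ∀ s t, 0 ≤ s → s ≤ t →
      IntervalIntegrable g volume s t := by
    intro g hg s t hs hst
    apply ContinuousOn.intervalIntegrable
    rw [Set.uIcc_of_le hst]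
    exact hg.mono (fun x hx => hs.trans hx.1)
  have hkey : ∀ T M, 0 ≤ T → b T 0 ^ 2 + κ * ∫ t in (0:ℝ)..T, ∑ j ∈ Finset.range M, b t j ^ 2 ≤ B := by
    intro T M hT
    obtain ⟨D, hD⟩ := hWle T hT
    have step : ∀ N, M ≤ N → b T 0 ^ 2 + κ * ∫ t in (0:ℝ)..T, ∑ j ∈ Finset.range M, b t j ^ 2
        ≤ B + T * D * θ ^ N := by
      intro N hN
      have w1 := dy_bound (hW N) (G := fun t => D * θ ^ N - κ * ∑ j ∈ Finset.range N, b t j ^ 2)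
        (continuousOn_const.sub (continuousOn_const.mul (hsumc N))) le_rfl hT
        (fun x hx hxT => hD N x hx hxT)
      rw [intervalIntegral.integral_sub (by simp)
        (hint (fun t => κ * ∑ j ∈ Finset.range N, b t j ^ 2)
          (continuousOn_const.mul (hsumc N)) _ _ le_rfl hT),
        intervalIntegral.integral_const, intervalIntegral.integral_const_mul, smul_eq_mul] at w1
      have w2 : ∫ t in (0:ℝ)..T, ∑ j ∈ Finset.range M, b t j ^ 2 ≤
          ∫ t in (0:ℝ)..T, ∑ j ∈ Finset.range N, b t j ^ 2 := by
        apply intervalIntegral.integral_mono_on hT (hint _ (hsumc M) _ _ le_rfl hT)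
          (hint _ (hsumc N) _ _ le_rfl hT)
        intro x _
        exact Finset.sum_le_sum_of_subset_of_nonneg
          (Finset.range_mono hN) (fun _ _ _ => sq_nonneg _)
      have w2' := mul_le_mul_of_nonneg_left w2 hκ0.le
      have w3 : ∑ j ∈ Finset.range (N+1), (1/2:ℝ) ^ j * b 0 j ^ 2 ≤ B := by
        refine le_trans (Finset.sum_le_sum (fun j _ => ?_))
          (hbS.sum_le_tsum (Finset.range (N+1)) (fun i _ => sq_nonneg _))
        have : (1/2:ℝ) ^ j ≤ 1 := pow_le_one₀ (by norm_num) (by norm_num)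
        nlinarith [sq_nonneg (b 0 j)]
      have w4 : b T 0 ^ 2 ≤ ∑ j ∈ Finset.range (N+1), (1/2:ℝ) ^ j * b T j ^ 2 := by
        have := Finset.single_le_sum (f := fun j => (1/2:ℝ) ^ j * b T j ^ 2)
          (s := Finset.range (N+1)) (fun i _ => by positivity) (a := 0) (by simp)
        simpa using this
      simp only [sub_zero] at w1
      nlinarith
    have lim : Tendsto (fun N : ℕ => B + T * D * θ ^ N) atTop (nhds (B + T * D * 0)) :=
      ((tendsto_pow_atTop_nhds_zero_of_lt_one hθ0 h2).const_mul _).const_add _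
    rw [mul_zero, add_zero] at lim
    exact ge_of_tendsto lim (eventually_atTop.mpr ⟨M, step⟩)
  -- conclusions
  have hintnn : ∀ T M, 0 ≤ T → 0 ≤ ∫ t in (0:ℝ)..T, ∑ j ∈ Finset.range M, b t j ^ 2 := by
    intro T M hT
    exact intervalIntegral.integral_nonneg hT (fun x _ => Finset.sum_nonneg (fun _ _ => sq_nonneg _))
  have hintB : ∀ T M, 0 ≤ T → ∫ t in (0:ℝ)..T, ∑ j ∈ Finset.range M, b t j ^ 2 ≤ B / κ := by
    intro T M hT
    rw [le_div_iff₀ hκ0]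
    have := hkey T M hT
    nlinarith [sq_nonneg (b T 0)]
  have ha0 : ∀ t, 0 ≤ t → a t 0 ≤ K + B + 1 := by
    intro t ht
    have e := hkey t 0 ht
    simp [hb] at e
    nlinarith [sq_nonneg (a t 0 - K - 1)]
  set S := ∑' j : ℕ, (K * r ^ j) ^ 2 with hSdef
  have hS0 : 0 ≤ S := tsum_nonneg (fun j => sq_nonneg _)
  set A := 2 * f * (K + B + 1) with hAdef
  have hA0 : 0 ≤ A := by positivity
  refine ⟨2 * S + 2 * (B / κ) + A + B / κ, by positivity, ?_⟩
  intro T hT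
  have hT0 : (0:ℝ) ≤ T := by linarith
  have hBκ : 0 ≤ B / κ := by positivity
  constructor
  · apply Real.tsum_le_of_sum_range_le (fun j => sq_nonneg _)
    intro n
    have m1 : ∑ j ∈ Finset.range n, a T j ^ 2 ≤ ∑ j ∈ Finset.range (n+1), a T j ^ 2 :=
      Finset.sum_le_sum_of_subset_of_nonneg (Finset.range_mono (by omega)) (fun _ _ _ => sq_nonneg _)
    refine m1.trans ?_
    have m2 : ∀ s, T - 1 ≤ s → s ≤ T → ∑ j ∈ Finset.range (n+1), a T j ^ 2 ≤
        2 * S + A + 2 * ∑ j ∈ Finset.range (n+1), b s j ^ 2 := by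
      intro s hs1 hs2
      have hs0 : 0 ≤ s := by linarith
      have n1 := hEle n s T hs0 hs2
      have n2 : ∫ x in s..T, 2 * f * a x 0 ≤ ∫ x in s..T, A := by
        apply intervalIntegral.integral_mono_on hs2
          (hint (fun x => 2 * f * a x 0) (continuousOn_const.mul (hcont 0)) _ _ hs0 hs2) (by simp)
        intro x hx
        rw [hAdef]
        have := ha0 x (hs0.trans hx.1)
        gcongr
      rw [intervalIntegral.integral_const, smul_eq_mul] at n2
      have n3 : (T - s) * A ≤ 1 * A := by gcongr; linarith
      have n4 : ∑ j ∈ Finset.range (n+1), a s j ^ 2 ≤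
          ∑ j ∈ Finset.range (n+1), (2 * (K * r ^ j) ^ 2 + 2 * b s j ^ 2) := by
        apply Finset.sum_le_sum
        intro j _
        simp only [hb]
        nlinarith [sq_nonneg (a s j - 2 * (K * r ^ j))]
      rw [Finset.sum_add_distrib, ← Finset.mul_sum, ← Finset.mul_sum] at n4
      have n5 := hαS.sum_le_tsum (Finset.range (n+1)) (fun i _ => sq_nonneg _)
      linarith
    have hT1 : 0 ≤ T - 1 := by linarith
    have hT2 : T - 1 ≤ T := by linarith
    have m3 : ∫ s in (T-1)..T, ∑ j ∈ Finset.range (n+1), a T j ^ 2 ≤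
        ∫ s in (T-1)..T, (2 * S + A + 2 * ∑ j ∈ Finset.range (n+1), b s j ^ 2) := by
      apply intervalIntegral.integral_mono_on hT2 (by simp)
        (hint (fun s => 2 * S + A + 2 * ∑ j ∈ Finset.range (n+1), b s j ^ 2)
          (continuousOn_const.add (continuousOn_const.mul (hsumc _))) _ _ hT1 hT2)
      intro x hx
      exact m2 x hx.1 hx.2
    rw [intervalIntegral.integral_add (by simp)
      (hint (fun s => 2 * ∑ j ∈ Finset.range (n+1), b s j ^ 2)
        (continuousOn_const.mul (hsumc _)) _ _ hT1 hT2), intervalIntegral.integral_const,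
      intervalIntegral.integral_const, intervalIntegral.integral_const_mul, smul_eq_mul,
      smul_eq_mul] at m3
    have m4 := intervalIntegral.integral_add_adjacent_intervals
      (hint _ (hsumc (n+1)) 0 (T-1) le_rfl hT1) (hint _ (hsumc (n+1)) (T-1) T hT1 hT2)
    have m5 := hintB T (n+1) hT0
    have m6 := hintnn (T-1) (n+1) hT1
    rw [sub_sub_cancel, one_mul, one_mul] at m3
    linarith
  · have := hintB T 1 hT0
    simp [hb] at this
    linarith

theorem stmt_15 (c f₀ : ℝ) (hc : c ∈ Set.Ioc (3 / 2 : ℝ) (5 / 2)) (hf : 0 < f₀)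
    (a : ℝ → ℕ → ℝ) (ha : IsSolution 0 c f₀ a) (hpos : ∀ j : ℕ, 0 ≤ a 0 j) :
    0 < (2 : ℝ) ^ (c / 6) * f₀ ^ ((3 : ℝ) / 2) ∧
    Tendsto
      (fun T : ℝ => (1 / T) *
        (((∑' j : ℕ, a 0 j ^ 2) - ∑' j : ℕ, a T j ^ 2) / 2
          + ∫ t in (0 : ℝ)..T, f₀ * a t 0))
      atTop (nhds ((2 : ℝ) ^ (c / 6) * f₀ ^ ((3 : ℝ) / 2))) := by
  refine ⟨by positivity, ?_⟩
  obtain ⟨hc1, hc2⟩ := hc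
  obtain ⟨hS, hd⟩ := ha
  have two : (0:ℝ) < 2 := two_pos
  set q : ℝ := 2 ^ c with hq
  set r : ℝ := 2 ^ (-c / 3) with hr
  set K : ℝ := 2 ^ (c / 6) * f₀ ^ ((1:ℝ) / 2) with hK
  have hq0 : 0 < q := by positivity
  have hr0 : 0 < r := by positivity
  have hK0 : 0 < K := by positivity
  have hqj : ∀ j : ℕ, (2:ℝ) ^ (c * (j:ℝ)) = q ^ j := by
    intro j; rw [hq, Real.rpow_mul two.le, Real.rpow_natCast]
  have hr2 : r ^ 2 = 2 ^ (-c / 3 * 2) := by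
    rw [hr, ← Real.rpow_natCast, ← Real.rpow_mul two.le]; norm_num
  have hqr : q * r ^ 3 = 1 := by
    rw [hr, ← Real.rpow_natCast, ← Real.rpow_mul two.le, hq, ← Real.rpow_add two]
    norm_num
  have hf2 : (f₀ ^ ((1:ℝ)/2)) ^ 2 = f₀ := by
    rw [← Real.rpow_natCast, ← Real.rpow_mul hf.le]; norm_num
  have hKf : K ^ 2 * r = f₀ := by
    have : ((2:ℝ) ^ (c/6)) ^ 2 * r = 1 := by
      rw [← Real.rpow_natCast, ← Real.rpow_mul two.le, hr, ← Real.rpow_add two]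
      rw [show c / 6 * ((2:ℕ):ℝ) + -c / 3 = 0 by push_cast; ring, Real.rpow_zero]
    rw [hK, mul_pow, hf2]
    linear_combination f₀ * this
  have hKval : (2 : ℝ) ^ (c / 6) * f₀ ^ ((3 : ℝ) / 2) = f₀ * K := by
    rw [show (3:ℝ)/2 = 1 + 1/2 by norm_num, Real.rpow_add hf, Real.rpow_one, hK]; ring
  have hr1 : r < 1 := Real.rpow_lt_one_of_one_lt_of_neg (by norm_num) (by linarith)
  have h1 : 1 ≤ q / 2 * r := by
    have : (2:ℝ) ^ (1:ℝ) ≤ q * r := by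
      rw [hq, hr, ← Real.rpow_add two]
      exact Real.rpow_le_rpow_of_exponent_le (by norm_num) (by linarith)
    rw [Real.rpow_one] at this
    linarith
  have h2 : q / 2 * r ^ 2 < 1 := by
    have : q * r ^ 2 < (2:ℝ) ^ (1:ℝ) := by
      rw [hr2, hq, ← Real.rpow_add two]
      exact Real.rpow_lt_rpow_of_exponent_lt (by norm_num) (by linarith)
    rw [Real.rpow_one] at this
    linarith
  obtain ⟨G, hG0, hG⟩ := dy_core hr0 hr1 hq0 hK0 hqr hKf h1 h2 a hS
    (by
      intro t ht
      convert hd 0 t ht using 1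
      simp [dyadicRHS])
    (by
      intro j t ht
      convert hd (j+1) t ht using 1
      have e1 := hqj j
      have e2 := hqj (j+1)
      push_cast at e2
      simp [dyadicRHS, e1, e2])
    hpos
  rw [hKval]
  have hcont : ContinuousOn (fun s => a s 0) (Set.Ici 0) :=
    fun t ht => (hd 0 t ht).continuousWithinAt
  set S := ∑' j : ℕ, a 0 j ^ 2 with hSdef
  have hS0 : 0 ≤ S := tsum_nonneg (fun j => sq_nonneg _)
  have lim : Tendsto (fun T : ℝ => (S + G + f₀ * (1 + G)) * (√T)⁻¹) atTop (nhds 0) := by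
    rw [← mul_zero (S + G + f₀ * (1 + G))]
    exact (tendsto_inv_atTop_zero.comp Real.tendsto_sqrt_atTop).const_mul _
  rw [tendsto_iff_dist_tendsto_zero]
  refine squeeze_zero' (Eventually.of_forall fun _ => dist_nonneg) ?_ lim
  filter_upwards [eventually_ge_atTop 1] with T hT
  obtain ⟨g1, g2⟩ := hG T hT
  have hT0 : 0 < T := by linarith
  have hE0 : 0 ≤ ∑' j, a T j ^ 2 := tsum_nonneg (fun j => sq_nonneg _)
  set w := √T with hw
  have hw1 : 1 ≤ w := Real.one_le_sqrt.mpr hT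
  have hww : w ^ 2 = T := Real.sq_sqrt hT0.le
  have hint : ∀ (g : ℝ → ℝ), ContinuousOn g (Set.Ici 0) → IntervalIntegrable g volume 0 T := by
    intro g hg
    apply ContinuousOn.intervalIntegrable
    rw [Set.uIcc_of_le hT0.le]
    exact hg.mono (fun x hx => hx.1)
  have hbc : ContinuousOn (fun s => a s 0 - K) (Set.Ici 0) := hcont.sub continuousOn_const
  have i1 : ∫ t in (0:ℝ)..T, f₀ * a t 0 = f₀ * ((∫ t in (0:ℝ)..T, (a t 0 - K)) + T * K) := by
    rw [intervalIntegral.integral_const_mul, intervalIntegral.integral_sub (hint _ hcont) (by simp)]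
    simp
  have i2 : |∫ t in (0:ℝ)..T, (a t 0 - K)| ≤ w * (1 + G) := by
    have j1 : |∫ t in (0:ℝ)..T, (a t 0 - K)| ≤ ∫ t in (0:ℝ)..T, |a t 0 - K| :=
      intervalIntegral.abs_integral_le_integral_abs hT0.le
    have j2 : ∫ t in (0:ℝ)..T, |a t 0 - K| ≤ ∫ t in (0:ℝ)..T, (w⁻¹ + w * (a t 0 - K) ^ 2) := by
      apply intervalIntegral.integral_mono_on hT0.le (hint _ hbc.abs)
        (hint (fun t => w⁻¹ + w * (a t 0 - K) ^ 2)
          (continuousOn_const.add (continuousOn_const.mul (hbc.pow 2))))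
      intro x _
      rw [← sq_abs (a x 0 - K)]
      generalize |a x 0 - K| = y
      have hw0 : 0 < w := by linarith
      have : w⁻¹ + w * y ^ 2 - y = w⁻¹ * ((w * y - 1/2) ^ 2 + 3/4) := by field_simp; ring
      have : 0 ≤ w⁻¹ * ((w * y - 1/2) ^ 2 + 3/4) := by positivity
      linarith
    rw [intervalIntegral.integral_add (by simp)
      (hint (fun t => w * (a t 0 - K) ^ 2) (continuousOn_const.mul (hbc.pow 2))),
      intervalIntegral.integral_const, intervalIntegral.integral_const_mul, smul_eq_mul, sub_zero] at j2
    have j3 : T * w⁻¹ = w := by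
      rw [← hww]; field_simp
    have j4 : w * ∫ t in (0:ℝ)..T, (a t 0 - K) ^ 2 ≤ w * G := by gcongr
    linarith
  rw [Real.dist_eq, i1]
  generalize (∫ t in (0:ℝ)..T, (a t 0 - K)) = I at *
  generalize (∑' j, a T j ^ 2) = E at *
  have hw0 : 0 < w := by linarith
  have e : 1 / T * ((S - E) / 2 + f₀ * (I + T * K)) - f₀ * K = ((S - E) / 2 + f₀ * I) / T := by
    field_simp; ring
  have e2 : (S + G + f₀ * (1 + G)) * w⁻¹ = ((S + G + f₀ * (1 + G)) * w) / T := by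
    rw [← hww]; field_simp
  rw [e, e2, abs_div, abs_of_pos hT0]
  gcongr
  have hfI : |f₀ * I| ≤ f₀ * (w * (1 + G)) := by
    rw [abs_mul, abs_of_pos hf]; gcongr
  have hSE : |(S - E) / 2| ≤ S + G := by
    rw [abs_le]; constructor <;> linarith
  have := abs_add_le ((S - E) / 2) (f₀ * I)
  nlinarith [mul_le_mul_of_nonneg_left hw1 (add_nonneg hS0 hG0)]
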